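/- Let F and C be independent real random variables on a common probability space, with F distributed as N(μ_f, σ_f²) and C distributed as N(μ_c, σ_c²), where σ_f > 0 and σ_c > 0. Let y⁺ ∈ ℝ, κ ∈ ℝ, α > 0, and β ∈ [0,1]. Then the additive expected constrained improvement has the closed form E[(1 − β)·𝟙{C ≥ 0}·max(y⁺ − F, 0) + β·(max(y⁺ − F, 0) + α·(κ − max(−C, 0)))] = (1 − β)·Φ(μ_c/σ_c)·EI + β·(EI + α·κ + α·(μ_c·Φ(z_c) − σ_c·φ(z_c))), where EI = (y⁺ − μ_f)·Φ(z_f) + σ_f·φ(z_f), z_f = (y⁺ − μ_f)/σ_f, and z_c = −μ_c/σ_c. -/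

import Mathlib

open MeasureTheory ProbabilityTheory Real

/-- The standard normal probability density function φ(s) = (2π)^{-1/2} exp(−s²/2). -/
noncomputable def stdNormalPDF (s : ℝ) : ℝ :=
  (Real.sqrt (2 * Real.pi))⁻¹ * Real.exp (-(s ^ 2) / 2)

/-- The standard normal cumulative distribution function Φ(t) = ∫_{−∞}^{t} φ(s) ds. -/
noncomputable def stdNormalCDF (t : ℝ) : ℝ :=
  ∫ s in Set.Iic t, stdNormalPDF s

open Filter Set
open scoped NNReal Topology

theorem stdNormalPDF_eq_gaussianPDFReal : stdNormalPDF = gaussianPDFReal 0 1 := by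
  ext s
  simp [stdNormalPDF, gaussianPDFReal]

theorem integrable_stdNormalPDF : Integrable stdNormalPDF := by
  rw [stdNormalPDF_eq_gaussianPDFReal]
  exact integrable_gaussianPDFReal 0 1

theorem integrable_mul_stdNormalPDF : Integrable fun s ↦ s * stdNormalPDF s := by
  refine ((integrable_mul_exp_neg_mul_sq (b := 1 / 2) (by norm_num)).const_mul
    (√(2 * π))⁻¹).congr (.of_forall fun s ↦ ?_)
  simp only [stdNormalPDF]
  rw [show -(1 / 2) * s ^ 2 = -(s ^ 2) / 2 by ring]
  ring

theorem hasDerivAt_stdNormalPDF (s : ℝ) : HasDerivAt stdNormalPDF (-(s * stdNormalPDF s)) s := by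
  have h : HasDerivAt (fun s : ℝ ↦ -(s ^ 2) / 2) (-s) s := by
    convert! ((hasDerivAt_pow 2 s).neg.div_const 2) using 1
    simp
    ring
  convert! h.exp.const_mul (√(2 * π))⁻¹ using 1
  simp only [stdNormalPDF]
  ring

theorem tendsto_stdNormalPDF_atBot : Tendsto stdNormalPDF atBot (𝓝 0) := by
  have h : Tendsto (fun s : ℝ ↦ -(s ^ 2) / 2) atBot atBot :=
    (tendsto_neg_atTop_atBot.comp
      (by simpa [sq] using tendsto_id.atBot_mul_atBot₀ tendsto_id)).atBot_div_const two_pos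
  rw [← mul_zero (√(2 * π))⁻¹]
  exact (tendsto_exp_atBot.comp h).const_mul (√(2 * π))⁻¹

theorem setIntegral_Iic_mul_stdNormalPDF (t : ℝ) :
    ∫ s in Iic t, s * stdNormalPDF s = -stdNormalPDF t := by
  simpa using integral_Iic_of_hasDerivAt_of_tendsto' (a := t) (m := -0)
    (f := fun s ↦ -stdNormalPDF s) (f' := fun s ↦ s * stdNormalPDF s)
    (fun s _ ↦ by simpa using (hasDerivAt_stdNormalPDF s).fun_neg)
    integrable_mul_stdNormalPDF.integrableOn tendsto_stdNormalPDF_atBot.neg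

/-- A Gaussian expectation as an integral against the standard normal density; the sign of the
scale `c` is free. -/
theorem integral_gaussianReal_eq_integral_stdNormalPDF {μ c : ℝ} {v : ℝ≥0} (hv : (v : ℝ) = c ^ 2)
    {f : ℝ → ℝ} (hf : Measurable f) :
    ∫ x, f x ∂gaussianReal μ v = ∫ s, stdNormalPDF s * f (c * s + μ) := by
  have hmap : (gaussianReal 0 1).map (fun s ↦ c * s + μ) = gaussianReal μ v := by
    have hcomp : (fun s ↦ c * s + μ) = (· + μ) ∘ (c * ·) := rfl
    rw [hcomp, ← Measure.map_map (by fun_prop) (by fun_prop), gaussianReal_map_const_mul,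
      gaussianReal_map_add_const]
    congr 1
    · simp
    · ext
      simp [hv]
  rw [← hmap, integral_map (by fun_prop) hf.aestronglyMeasurable,
    integral_gaussianReal_eq_integral_smul one_ne_zero, stdNormalPDF_eq_gaussianPDFReal]
  simp

/-- The Gaussian expected improvement. -/
theorem integral_max_sub_gaussianReal {μ σ : ℝ} (hσ : 0 < σ) {v : ℝ≥0} (hv : (v : ℝ) = σ ^ 2)
    (y : ℝ) :
    ∫ x, max (y - x) 0 ∂gaussianReal μ v =
      (y - μ) * stdNormalCDF ((y - μ) / σ) + σ * stdNormalPDF ((y - μ) / σ) := by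
  have hind : (fun s ↦ stdNormalPDF s * max (y - (σ * s + μ)) 0) =
      (Iic ((y - μ) / σ)).indicator
        fun s ↦ (y - μ) * stdNormalPDF s - σ * (s * stdNormalPDF s) := by
    ext s
    by_cases hs : s ≤ (y - μ) / σ
    · rw [indicator_of_mem (mem_Iic.2 hs), max_eq_left]
      · ring
      · linarith [(le_div_iff₀' hσ).1 hs]
    · rw [indicator_of_notMem (by simpa using hs), max_eq_right, mul_zero]
      linarith [(div_lt_iff₀' hσ).1 (not_le.1 hs)]
  rw [integral_gaussianReal_eq_integral_stdNormalPDF hv (by fun_prop), hind,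
    integral_indicator measurableSet_Iic,
    integral_sub (integrable_stdNormalPDF.integrableOn.const_mul _)
      (integrable_mul_stdNormalPDF.integrableOn.const_mul _),
    integral_const_mul, integral_const_mul, setIntegral_Iic_mul_stdNormalPDF, stdNormalCDF]
  ring

theorem measurable_ite_nonneg : Measurable fun x : ℝ ↦ if 0 ≤ x then (1 : ℝ) else 0 :=
  Measurable.ite measurableSet_Ici measurable_const measurable_const

theorem integral_ite_nonneg_gaussianReal {μ σ : ℝ} (hσ : 0 < σ) {v : ℝ≥0}
    (hv : (v : ℝ) = σ ^ 2) :
    ∫ x, (if 0 ≤ x then (1 : ℝ) else 0) ∂gaussianReal μ v = stdNormalCDF (μ / σ) := by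
  rw [integral_gaussianReal_eq_integral_stdNormalPDF (c := -σ) (by rw [hv, neg_sq])
    measurable_ite_nonneg, stdNormalCDF, ← integral_indicator measurableSet_Iic]
  congr 1 with s
  have hiff : 0 ≤ -σ * s + μ ↔ s ∈ Iic (μ / σ) := by
    rw [mem_Iic, le_div_iff₀' hσ]
    constructor <;> intro h <;> linarith
  simp only [indicator_apply, hiff, mul_ite, mul_one, mul_zero]

/-- Additive expected constrained improvement: if F ~ N(μ_f, σ_f²) and C ~ N(μ_c, σ_c²)
are independent, σ_f, σ_c > 0, y⁺, κ ∈ ℝ, α > 0, β ∈ [0,1], then, with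
EI = (y⁺ − μ_f)·Φ(z_f) + σ_f·φ(z_f), z_f = (y⁺ − μ_f)/σ_f, z_c = −μ_c/σ_c,
E[(1 − β)·𝟙{C ≥ 0}·max(y⁺ − F, 0) + β·(max(y⁺ − F, 0) + α·(κ − max(−C, 0)))]
  = (1 − β)·Φ(μ_c/σ_c)·EI + β·(EI + α·κ + α·(μ_c·Φ(z_c) − σ_c·φ(z_c))). -/
theorem additive_expected_constrained_improvement_gaussian {Ω : Type*} [MeasurableSpace Ω]
    (P : Measure Ω) [IsProbabilityMeasure P]
    (F C : Ω → ℝ) (hF : Measurable F) (hC : Measurable C)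
    (hindep : IndepFun F C P)
    (μf σf μc σc : ℝ) (hσf : 0 < σf) (hσc : 0 < σc)
    (hFdist : P.map F = gaussianReal μf ⟨σf ^ 2, sq_nonneg σf⟩)
    (hCdist : P.map C = gaussianReal μc ⟨σc ^ 2, sq_nonneg σc⟩)
    (yplus κ α β : ℝ) (hα : 0 < α) (hβ : β ∈ Set.Icc (0 : ℝ) 1) :
    (∫ ω, ((1 - β) * ((if 0 ≤ C ω then (1 : ℝ) else 0) * max (yplus - F ω) 0)
        + β * (max (yplus - F ω) 0 + α * (κ - max (-(C ω)) 0))) ∂P)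
      = (1 - β) * stdNormalCDF (μc / σc)
            * ((yplus - μf) * stdNormalCDF ((yplus - μf) / σf)
                + σf * stdNormalPDF ((yplus - μf) / σf))
        + β * (((yplus - μf) * stdNormalCDF ((yplus - μf) / σf)
                + σf * stdNormalPDF ((yplus - μf) / σf))
            + α * κ
            + α * (μc * stdNormalCDF (-μc / σc) - σc * stdNormalPDF (-μc / σc))) := by
  set v : ℝ≥0 := ⟨σf ^ 2, sq_nonneg σf⟩
  set w : ℝ≥0 := ⟨σc ^ 2, sq_nonneg σc⟩
  have hmeas (y : ℝ) : Measurable fun x : ℝ ↦ max (y - x) 0 := by fun_prop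
  have hmaxint {X : Ω → ℝ} (hX : Measurable X) {m : ℝ} {u : ℝ≥0}
      (hd : P.map X = gaussianReal m u)
      (y : ℝ) : Integrable (fun ω ↦ max (y - X ω) 0) P := by
    have hXint : Integrable X P := by
      have hid : Integrable id (P.map X) := hd ▸ (memLp_id_gaussianReal 1).integrable le_rfl
      exact hid.comp_measurable hX
    exact ((integrable_const y).sub hXint).pos_part
  have hEI : ∫ ω, max (yplus - F ω) 0 ∂P = (yplus - μf) * stdNormalCDF ((yplus - μf) / σf)
      + σf * stdNormalPDF ((yplus - μf) / σf) := by
    rw [← integral_max_sub_gaussianReal hσf (v := v) rfl, ← hFdist,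
      integral_map hF.aemeasurable (hmeas yplus).aestronglyMeasurable]
  have hviol : ∫ ω, max (-(C ω)) 0 ∂P
      = -(μc * stdNormalCDF (-μc / σc) - σc * stdNormalPDF (-μc / σc)) := by
    have h := integral_max_sub_gaussianReal (μ := μc) hσc (v := w) rfl 0
    rw [← hCdist, integral_map hC.aemeasurable (hmeas 0).aestronglyMeasurable] at h
    simp only [zero_sub] at h
    rw [h]
    ring
  have hfeas : ∫ ω, (if 0 ≤ C ω then (1 : ℝ) else 0) ∂P = stdNormalCDF (μc / σc) := by
    rw [← integral_ite_nonneg_gaussianReal hσc (v := w) rfl, ← hCdist,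
      integral_map hC.aemeasurable measurable_ite_nonneg.aestronglyMeasurable]
  have hindep' : IndepFun (fun ω ↦ if 0 ≤ C ω then (1 : ℝ) else 0)
      (fun ω ↦ max (yplus - F ω) 0) P :=
    hindep.symm.comp measurable_ite_nonneg (hmeas yplus)
  have hIint : Integrable (fun ω ↦ if 0 ≤ C ω then (1 : ℝ) else 0) P :=
    .of_bound (measurable_ite_nonneg.comp hC).aestronglyMeasurable 1
      (.of_forall fun ω ↦ by split_ifs <;> simp)
  have hFint := hmaxint hF hFdist yplus
  have hCint : Integrable (fun ω ↦ max (-(C ω)) 0) P := by simpa using hmaxint hC hCdist 0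
  have hprod : Integrable (fun ω ↦ (if 0 ≤ C ω then (1 : ℝ) else 0) * max (yplus - F ω) 0) P :=
    hindep'.integrable_mul hIint hFint
  have hpen : Integrable (fun ω ↦ α * (κ - max (-(C ω)) 0)) P :=
    ((integrable_const κ).sub hCint).const_mul α
  have hsum : Integrable (fun ω ↦ max (yplus - F ω) 0 + α * (κ - max (-(C ω)) 0)) P :=
    hFint.add hpen
  rw [integral_add (hprod.const_mul _) (hsum.const_mul β), integral_const_mul,
    integral_const_mul, integral_add hFint hpen, integral_const_mul,
    integral_sub (integrable_const κ) hCint,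
    hindep'.integral_fun_mul_eq_mul_integral hIint.aestronglyMeasurable
      hFint.aestronglyMeasurable, hEI, hviol, hfeas]
  simp only [integral_const, probReal_univ, one_smul]
  ring
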